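/- Formalized ΣB-completeness theorem: for every ΣB formula φ, PA(K4) proves φ → □φ. -/

import Mathlib

namespace ModalArith

/-- Terms of the language of arithmetic L_A = {0, S, +, ×, ≤, =}. -/
inductive Term : Type
  | var : ℕ → Term
  | zero : Term
  | succ : Term → Term
  | add : Term → Term → Term
  | mul : Term → Term → Term
  deriving DecidableEq

namespace Term

/-- Free variables of a term. -/
def fv : Term → Finset ℕ
  | var x => {x}
  | zero => ∅
  | succ t => fv t
  | add t u => fv t ∪ fv u
  | mul t u => fv t ∪ fv u

/-- Simultaneous substitution of terms for variables. -/
def substAll : Term → (ℕ → Term) → Term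
  | var x, v => v x
  | zero, _ => zero
  | succ t, v => succ (substAll t v)
  | add t u, v => add (substAll t v) (substAll u v)
  | mul t u, v => mul (substAll t v) (substAll u v)

/-- Substitution of the term `s` for the variable `x`. -/
def subst (x : ℕ) (s : Term) (t : Term) : Term :=
  substAll t (Function.update Term.var x s)

/-- The numeral `n̄`. -/
def numeral : ℕ → Term
  | 0 => zero
  | n + 1 => succ (numeral n)

/-- Value of a term in the standard model under a valuation. -/
def val : Term → (ℕ → ℕ) → ℕ
  | var x, v => v x
  | zero, _ => 0
  | succ t, v => val t v + 1
  | add t u, v => val t v + val u v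
  | mul t u, v => val t v * val u v

/-- A Gödel numbering of terms. -/
def code : Term → ℕ
  | var x => Nat.pair 0 x
  | zero => Nat.pair 1 0
  | succ t => Nat.pair 2 (code t)
  | add t u => Nat.pair 3 (Nat.pair (code t) (code u))
  | mul t u => Nat.pair 4 (Nat.pair (code t) (code u))

end Term

/-- Formulas of the language L_□ of modal arithmetic. -/
inductive Formula : Type
  | falsum : Formula
  | eq : Term → Term → Formula
  | le : Term → Term → Formula
  | and : Formula → Formula → Formula
  | or : Formula → Formula → Formula
  | imp : Formula → Formula → Formula
  | neg : Formula → Formula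
  | all : ℕ → Formula → Formula
  | ex : ℕ → Formula → Formula
  | box : Formula → Formula
  deriving DecidableEq

namespace Formula

/-- Free variables of a formula. -/
def fv : Formula → Finset ℕ
  | falsum => ∅
  | eq t u => t.fv ∪ u.fv
  | le t u => t.fv ∪ u.fv
  | and φ ψ => fv φ ∪ fv ψ
  | or φ ψ => fv φ ∪ fv ψ
  | imp φ ψ => fv φ ∪ fv ψ
  | neg φ => fv φ
  | all x φ => (fv φ).erase x
  | ex x φ => (fv φ).erase x
  | box φ => fv φ

/-- Simultaneous substitution of terms for the free variables of a formula. -/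
def substAll : Formula → (ℕ → Term) → Formula
  | falsum, _ => falsum
  | eq t u, v => eq (t.substAll v) (u.substAll v)
  | le t u, v => le (t.substAll v) (u.substAll v)
  | and φ ψ, v => and (substAll φ v) (substAll ψ v)
  | or φ ψ, v => or (substAll φ v) (substAll ψ v)
  | imp φ ψ, v => imp (substAll φ v) (substAll ψ v)
  | neg φ, v => neg (substAll φ v)
  | all x φ, v => all x (substAll φ (Function.update v x (Term.var x)))
  | ex x φ, v => ex x (substAll φ (Function.update v x (Term.var x)))
  | box φ, v => box (substAll φ v)

/-- Substitution of the term `s` for the free occurrences of the variable `x`. -/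
def subst (x : ℕ) (s : Term) (φ : Formula) : Formula :=
  substAll φ (Function.update Term.var x s)

/-- The term `s` is substitutable (free) for the variable `x` in the formula. -/
def freeFor (s : Term) (x : ℕ) : Formula → Prop
  | falsum => True
  | eq _ _ => True
  | le _ _ => True
  | and φ ψ => freeFor s x φ ∧ freeFor s x ψ
  | or φ ψ => freeFor s x φ ∧ freeFor s x ψ
  | imp φ ψ => freeFor s x φ ∧ freeFor s x ψ
  | neg φ => freeFor s x φ
  | all y φ => x = y ∨ x ∉ fv φ ∨ (y ∉ s.fv ∧ freeFor s x φ)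
  | ex y φ => x = y ∨ x ∉ fv φ ∨ (y ∉ s.fv ∧ freeFor s x φ)
  | box φ => freeFor s x φ

/-- The formula is an L_A-formula (contains no □). -/
def noBox : Formula → Prop
  | falsum => True
  | eq _ _ => True
  | le _ _ => True
  | and φ ψ => noBox φ ∧ noBox ψ
  | or φ ψ => noBox φ ∧ noBox ψ
  | imp φ ψ => noBox φ ∧ noBox ψ
  | neg φ => noBox φ
  | all _ φ => noBox φ
  | ex _ φ => noBox φ
  | box _ => False

/-- Truth in the standard model ℕ under a valuation (meaningful for L_A-formulas;
boxed formulas are given the dummy value `False`). -/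
def val : Formula → (ℕ → ℕ) → Prop
  | falsum, _ => False
  | eq t u, v => t.val v = u.val v
  | le t u, v => t.val v ≤ u.val v
  | and φ ψ, v => val φ v ∧ val ψ v
  | or φ ψ, v => val φ v ∨ val ψ v
  | imp φ ψ, v => val φ v → val ψ v
  | neg φ, v => ¬ val φ v
  | all x φ, v => ∀ n : ℕ, val φ (Function.update v x n)
  | ex x φ, v => ∃ n : ℕ, val φ (Function.update v x n)
  | box _, _ => False

/-- Biconditional, as an abbreviation. -/
def iff (φ ψ : Formula) : Formula := (φ.imp ψ).and (ψ.imp φ)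

/-- `t < u` abbreviates `S t ≤ u`. -/
def lt (t u : Term) : Formula := le (Term.succ t) u

/-- Bounded universal quantification `∀ x < t, φ`. -/
def ball (x : ℕ) (t : Term) (φ : Formula) : Formula :=
  all x ((lt (Term.var x) t).imp φ)

/-- Bounded existential quantification `∃ x < t, φ`. -/
def bex (x : ℕ) (t : Term) (φ : Formula) : Formula :=
  ex x ((lt (Term.var x) t).and φ)

/-- A Gödel numbering of formulas. -/
def code : Formula → ℕ
  | falsum => Nat.pair 0 0
  | eq t u => Nat.pair 1 (Nat.pair t.code u.code)
  | le t u => Nat.pair 2 (Nat.pair t.code u.code)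
  | and φ ψ => Nat.pair 3 (Nat.pair (code φ) (code ψ))
  | or φ ψ => Nat.pair 4 (Nat.pair (code φ) (code ψ))
  | imp φ ψ => Nat.pair 5 (Nat.pair (code φ) (code ψ))
  | neg φ => Nat.pair 6 (code φ)
  | all x φ => Nat.pair 7 (Nat.pair x (code φ))
  | ex x φ => Nat.pair 8 (Nat.pair x (code φ))
  | box φ => Nat.pair 9 (code φ)

end Formula

/-- A sentence is a formula with no free variables. -/
def Sentence (φ : Formula) : Prop := φ.fv = ∅

/-- Truth in the standard model ℕ (for sentences; any fixed valuation will do). -/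
def StdTrue (φ : Formula) : Prop := φ.val fun _ => 0

/-- The logical axioms of classical first-order logic with equality for L_□,
with the identity axioms only for atomic formulas. -/
inductive LogicalAxiom : Formula → Prop
  | imp1 (φ ψ : Formula) : LogicalAxiom (φ.imp (ψ.imp φ))
  | imp2 (φ ψ χ : Formula) :
      LogicalAxiom ((φ.imp (ψ.imp χ)).imp ((φ.imp ψ).imp (φ.imp χ)))
  | dne (φ : Formula) : LogicalAxiom (φ.neg.neg.imp φ)
  | negI (φ ψ : Formula) : LogicalAxiom ((φ.imp ψ).imp ((φ.imp ψ.neg).imp φ.neg))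
  | negE (φ ψ : Formula) : LogicalAxiom (φ.neg.imp (φ.imp ψ))
  | falsumE (φ : Formula) : LogicalAxiom (Formula.falsum.imp φ)
  | negIntro (φ : Formula) : LogicalAxiom ((φ.imp Formula.falsum).imp φ.neg)
  | negElimFalsum (φ : Formula) : LogicalAxiom (φ.neg.imp (φ.imp Formula.falsum))
  | andI (φ ψ : Formula) : LogicalAxiom (φ.imp (ψ.imp (φ.and ψ)))
  | andE1 (φ ψ : Formula) : LogicalAxiom ((φ.and ψ).imp φ)
  | andE2 (φ ψ : Formula) : LogicalAxiom ((φ.and ψ).imp ψ)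
  | orI1 (φ ψ : Formula) : LogicalAxiom (φ.imp (φ.or ψ))
  | orI2 (φ ψ : Formula) : LogicalAxiom (ψ.imp (φ.or ψ))
  | orE (φ ψ χ : Formula) :
      LogicalAxiom ((φ.imp χ).imp ((ψ.imp χ).imp ((φ.or ψ).imp χ)))
  | allE (x : ℕ) (t : Term) (φ : Formula) :
      φ.freeFor t x → LogicalAxiom ((Formula.all x φ).imp (φ.subst x t))
  | allImp (x : ℕ) (φ ψ : Formula) :
      x ∉ φ.fv → LogicalAxiom ((Formula.all x (φ.imp ψ)).imp (φ.imp (Formula.all x ψ)))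
  | exI (x : ℕ) (t : Term) (φ : Formula) :
      φ.freeFor t x → LogicalAxiom ((φ.subst x t).imp (Formula.ex x φ))
  | exE (x : ℕ) (φ ψ : Formula) :
      x ∉ ψ.fv → LogicalAxiom ((Formula.all x (φ.imp ψ)).imp ((Formula.ex x φ).imp ψ))
  | eqRefl (t : Term) : LogicalAxiom (Formula.eq t t)
  | eqSymm (t u : Term) : LogicalAxiom ((Formula.eq t u).imp (Formula.eq u t))
  | eqTrans (t u w : Term) :
      LogicalAxiom ((Formula.eq t u).imp ((Formula.eq u w).imp (Formula.eq t w)))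
  | eqSucc (t u : Term) :
      LogicalAxiom ((Formula.eq t u).imp (Formula.eq t.succ u.succ))
  | eqAdd (t₁ t₂ u₁ u₂ : Term) :
      LogicalAxiom ((Formula.eq t₁ t₂).imp ((Formula.eq u₁ u₂).imp
        (Formula.eq (t₁.add u₁) (t₂.add u₂))))
  | eqMul (t₁ t₂ u₁ u₂ : Term) :
      LogicalAxiom ((Formula.eq t₁ t₂).imp ((Formula.eq u₁ u₂).imp
        (Formula.eq (t₁.mul u₁) (t₂.mul u₂))))
  | eqLe (t₁ t₂ u₁ u₂ : Term) :
      LogicalAxiom ((Formula.eq t₁ t₂).imp ((Formula.eq u₁ u₂).imp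
        ((Formula.le t₁ u₁).imp (Formula.le t₂ u₂))))

/-- Provability in an L_□-theory: logical axioms, the axioms of the theory, and the
rules modus ponens, generalization, and necessitation. -/
inductive Provable (T : Set Formula) : Formula → Prop
  | ax {φ : Formula} : φ ∈ T → Provable T φ
  | logic {φ : Formula} : LogicalAxiom φ → Provable T φ
  | mp {φ ψ : Formula} : Provable T (φ.imp ψ) → Provable T φ → Provable T ψ
  | gen {φ : Formula} (x : ℕ) : Provable T φ → Provable T (Formula.all x φ)
  | nec {φ : Formula} : Provable T φ → Provable T (Formula.box φ)

/-- First-order provability (no necessitation rule); used for the non-modal theory PA. -/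
inductive FOProvable (T : Set Formula) : Formula → Prop
  | ax {φ : Formula} : φ ∈ T → FOProvable T φ
  | logic {φ : Formula} : LogicalAxiom φ → FOProvable T φ
  | mp {φ ψ : Formula} : FOProvable T (φ.imp ψ) → FOProvable T φ → FOProvable T ψ
  | gen {φ : Formula} (x : ℕ) : FOProvable T φ → FOProvable T (Formula.all x φ)

/-- Basic (Robinson-style) axioms of arithmetic. -/
def succNeZero : Formula := (Formula.eq (Term.succ (Term.var 0)) Term.zero).neg
def succInj : Formula :=
  (Formula.eq (Term.succ (Term.var 0)) (Term.succ (Term.var 1))).imp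
    (Formula.eq (Term.var 0) (Term.var 1))
def addZero : Formula := Formula.eq (Term.add (Term.var 0) Term.zero) (Term.var 0)
def addSucc : Formula :=
  Formula.eq (Term.add (Term.var 0) (Term.succ (Term.var 1)))
    (Term.succ (Term.add (Term.var 0) (Term.var 1)))
def mulZero : Formula := Formula.eq (Term.mul (Term.var 0) Term.zero) Term.zero
def mulSucc : Formula :=
  Formula.eq (Term.mul (Term.var 0) (Term.succ (Term.var 1)))
    (Term.add (Term.mul (Term.var 0) (Term.var 1)) (Term.var 0))
def leDef : Formula :=
  (Formula.le (Term.var 0) (Term.var 1)).iff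
    (Formula.ex 2 (Formula.eq (Term.add (Term.var 0) (Term.var 2)) (Term.var 1)))

def baseAxioms : Set Formula :=
  {succNeZero, succInj, addZero, addSucc, mulZero, mulSucc, leDef}

/-- The induction axiom for the formula `φ` and the variable `x`. -/
def inductionAx (x : ℕ) (φ : Formula) : Formula :=
  ((φ.subst x Term.zero).and
    (Formula.all x (φ.imp (φ.subst x (Term.succ (Term.var x)))))).imp
      (Formula.all x φ)

/-- Peano arithmetic PA: basic axioms plus induction for L_A-formulas. -/
def PA : Set Formula :=
  baseAxioms ∪ {χ | ∃ (x : ℕ) (φ : Formula), φ.noBox ∧ χ = inductionAx x φ}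

/-- PA_□ : basic axioms plus induction for all L_□-formulas. -/
def PABox : Set Formula :=
  baseAxioms ∪ {χ | ∃ (x : ℕ) (φ : Formula), χ = inductionAx x φ}

/-- The distribution axiom K. -/
def axK (φ ψ : Formula) : Formula :=
  (Formula.box (φ.imp ψ)).imp ((Formula.box φ).imp (Formula.box ψ))

/-- PA(K). -/
def PAK : Set Formula := PABox ∪ {χ | ∃ φ ψ : Formula, χ = axK φ ψ}

/-- The axiom 4. -/
def ax4 (φ : Formula) : Formula := (Formula.box φ).imp (Formula.box (Formula.box φ))

/-- PA(K4). -/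
def PAK4 : Set Formula := PAK ∪ {χ | ∃ φ : Formula, χ = ax4 φ}

/-- The axiom of Triv. -/
def axTriv (φ : Formula) : Formula := (Formula.box φ).iff φ

/-- PA(Triv). -/
def PATriv : Set Formula := PAK ∪ {χ | ∃ φ : Formula, χ = axTriv φ}

/-- PA(Ver). -/
def PAVer : Set Formula := PAK ∪ {Formula.box Formula.falsum}

/-- `T` extends `U`: every axiom of `U` is provable in `T`. -/
def Extends (T U : Set Formula) : Prop := ∀ φ ∈ U, Provable T φ

/-- Consistency. -/
def Consistent (T : Set Formula) : Prop := ¬ Provable T Formula.falsum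

/-- The class Δ₀ of bounded L_A-formulas. -/
inductive IsDelta0 : Formula → Prop
  | falsum : IsDelta0 Formula.falsum
  | eq (t u : Term) : IsDelta0 (Formula.eq t u)
  | le (t u : Term) : IsDelta0 (Formula.le t u)
  | and {φ ψ : Formula} : IsDelta0 φ → IsDelta0 ψ → IsDelta0 (φ.and ψ)
  | or {φ ψ : Formula} : IsDelta0 φ → IsDelta0 ψ → IsDelta0 (φ.or ψ)
  | imp {φ ψ : Formula} : IsDelta0 φ → IsDelta0 ψ → IsDelta0 (φ.imp ψ)
  | neg {φ : Formula} : IsDelta0 φ → IsDelta0 φ.neg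
  | ball {x : ℕ} {t : Term} {φ : Formula} :
      x ∉ t.fv → IsDelta0 φ → IsDelta0 (Formula.ball x t φ)
  | bex {x : ℕ} {t : Term} {φ : Formula} :
      x ∉ t.fv → IsDelta0 φ → IsDelta0 (Formula.bex x t φ)

/-- The class Σ₁ of L_A-formulas. -/
inductive IsSigma1 : Formula → Prop
  | delta0 {φ : Formula} : IsDelta0 φ → IsSigma1 φ
  | and {φ ψ : Formula} : IsSigma1 φ → IsSigma1 ψ → IsSigma1 (φ.and ψ)
  | or {φ ψ : Formula} : IsSigma1 φ → IsSigma1 ψ → IsSigma1 (φ.or ψ)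
  | ex {x : ℕ} {φ : Formula} : IsSigma1 φ → IsSigma1 (Formula.ex x φ)
  | ball {x : ℕ} {t : Term} {φ : Formula} :
      x ∉ t.fv → IsSigma1 φ → IsSigma1 (Formula.ball x t φ)

/-- The class B of boxed formulas. -/
def IsB (φ : Formula) : Prop := ∃ ψ : Formula, φ = Formula.box ψ

/-- The class ΔB. -/
inductive IsDeltaB : Formula → Prop
  | delta0 {φ : Formula} : IsDelta0 φ → IsDeltaB φ
  | b (ψ : Formula) : IsDeltaB (Formula.box ψ)
  | and {φ ψ : Formula} : IsDeltaB φ → IsDeltaB ψ → IsDeltaB (φ.and ψ)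
  | or {φ ψ : Formula} : IsDeltaB φ → IsDeltaB ψ → IsDeltaB (φ.or ψ)
  | ball {x : ℕ} {t : Term} {φ : Formula} :
      x ∉ t.fv → IsDeltaB φ → IsDeltaB (Formula.ball x t φ)
  | bex {x : ℕ} {t : Term} {φ : Formula} :
      x ∉ t.fv → IsDeltaB φ → IsDeltaB (Formula.bex x t φ)

/-- The class ΣB. -/
inductive IsSigmaB : Formula → Prop
  | sigma1 {φ : Formula} : IsSigma1 φ → IsSigmaB φ
  | b (ψ : Formula) : IsSigmaB (Formula.box ψ)
  | and {φ ψ : Formula} : IsSigmaB φ → IsSigmaB ψ → IsSigmaB (φ.and ψ)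
  | or {φ ψ : Formula} : IsSigmaB φ → IsSigmaB ψ → IsSigmaB (φ.or ψ)
  | ex {x : ℕ} {φ : Formula} : IsSigmaB φ → IsSigmaB (Formula.ex x φ)
  | ball {x : ℕ} {t : Term} {φ : Formula} :
      x ∉ t.fv → IsSigmaB φ → IsSigmaB (Formula.ball x t φ)

/-- Iterated disjunction (the empty disjunction is ⊥). -/
def disj : List Formula → Formula
  | [] => Formula.falsum
  | [φ] => φ
  | φ :: ψ :: l => φ.or (disj (ψ :: l))

/-- Iterated conjunction (the empty conjunction is ⊤). -/
def conj : List Formula → Formula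
  | [] => Formula.falsum.neg
  | [φ] => φ
  | φ :: ψ :: l => φ.and (conj (ψ :: l))

/-- Γ-disjunction property. -/
def HasDP (T : Set Formula) (Γ : Formula → Prop) : Prop :=
  ∀ φ ψ : Formula, Γ φ → Γ ψ → Sentence φ → Sentence ψ →
    Provable T (φ.or ψ) → Provable T φ ∨ Provable T ψ

/-- (Γ, Θ)-disjunction property. -/
def HasDP2 (T : Set Formula) (Γ Θ : Formula → Prop) : Prop :=
  ∀ φ ψ : Formula, Γ φ → Θ ψ → Sentence φ → Sentence ψ →
    Provable T (φ.or ψ) → Provable T φ ∨ Provable T ψ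

/-- Γ-existence property. -/
def HasEP (T : Set Formula) (Γ : Formula → Prop) : Prop :=
  ∀ (x : ℕ) (φ : Formula), Γ φ → φ.fv ⊆ {x} →
    Provable T (Formula.ex x φ) → ∃ n : ℕ, Provable T (φ.subst x (Term.numeral n))

/-- Modal disjunction property. -/
def HasMDP (T : Set Formula) : Prop :=
  ∀ φ ψ : Formula, Sentence φ → Sentence ψ →
    Provable T ((Formula.box φ).or (Formula.box ψ)) → Provable T φ ∨ Provable T ψ

/-- Modal existence property. -/
def HasMEP (T : Set Formula) : Prop :=
  ∀ (x : ℕ) (φ : Formula), φ.fv ⊆ {x} →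
    Provable T (Formula.ex x (Formula.box φ)) →
      ∃ n : ℕ, Provable T (φ.subst x (Term.numeral n))

/-- n-fold B-disjunction property. -/
def HasBnDP (T : Set Formula) (n : ℕ) : Prop :=
  ∀ φ : Fin n → Formula, (∀ i, Sentence (φ i)) →
    Provable T (disj (List.ofFn fun i => Formula.box (φ i))) →
    ∃ i, Provable T (Formula.box (φ i))

/-- Σ₁-soundness. -/
def Sigma1Sound (T : Set Formula) : Prop :=
  ∀ φ : Formula, IsSigma1 φ → Sentence φ → Provable T φ → StdTrue φ

/-- L_A-soundness. -/
def LASound (T : Set Formula) : Prop :=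
  ∀ φ : Formula, φ.noBox → Sentence φ → Provable T φ → StdTrue φ

/-- `T` is recursively enumerable (via the Gödel numbering of formulas). -/
def RE (T : Set Formula) : Prop :=
  Nat.Partrec fun n => Part.assert (∃ φ ∈ T, Formula.code φ = n) fun _ => Part.some 0

/-- A fixed natural Σ₁ provability predicate `Pr_T(x)` for the theory `T`:
a Σ₁ L_A-formula with only the free variable `0` which numerates provability in `T`
in the standard model and satisfies the standard derivability conditions
(provably in PA). -/
structure ProvPred (T : Set Formula) where
  pr : Formula
  noBox : pr.noBox
  sigma1 : IsSigma1 pr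
  fvSub : pr.fv ⊆ {0}
  numerates : ∀ φ : Formula,
    StdTrue (pr.subst 0 (Term.numeral φ.code)) ↔ Provable T φ
  d1 : ∀ φ : Formula, Provable T φ → FOProvable PA (pr.subst 0 (Term.numeral φ.code))
  d2 : ∀ φ ψ : Formula,
    FOProvable PA ((pr.subst 0 (Term.numeral (φ.imp ψ).code)).imp
      ((pr.subst 0 (Term.numeral φ.code)).imp (pr.subst 0 (Term.numeral ψ.code))))
  necClosed : ∀ φ : Formula,
    FOProvable PA ((pr.subst 0 (Term.numeral φ.code)).imp
      (pr.subst 0 (Term.numeral (Formula.box φ).code)))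

/-- `Pr_T(⌜φ⌝)`. -/
def ProvPred.app {T : Set Formula} (P : ProvPred T) (φ : Formula) : Formula :=
  P.pr.subst 0 (Term.numeral φ.code)

/-- Γ-disjunctive correctness (Γ-DC). -/
def DC (T : Set Formula) (P : ProvPred T) (Γ : Formula → Prop) : Prop :=
  ∀ φ : Formula, Γ φ → Sentence φ → Provable T (φ.or (P.app φ)) → Provable T φ

/-- The substitution replacing each variable by the numeral of its value. -/
def numeralSubst (v : ℕ → ℕ) : ℕ → Term := fun x => Term.numeral (v x)

/-- Standard-model satisfaction of the ρ_T-translation: `ρ_T` is the identity on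
L_A-formulas, commutes with connectives and quantifiers, and sends `□φ(x⃗)` to
`Pr_T(⌜□φ(ẋ⃗)⌝)`, whose truth in ℕ (for a natural provability predicate) amounts to
provability in `T` of `□φ(n̄⃗)`. -/
def RhoSat (T : Set Formula) : Formula → (ℕ → ℕ) → Prop
  | .falsum, _ => False
  | .eq t u, v => t.val v = u.val v
  | .le t u, v => t.val v ≤ u.val v
  | .and φ ψ, v => RhoSat T φ v ∧ RhoSat T ψ v
  | .or φ ψ, v => RhoSat T φ v ∨ RhoSat T ψ v
  | .imp φ ψ, v => RhoSat T φ v → RhoSat T ψ v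
  | .neg φ, v => ¬ RhoSat T φ v
  | .all x φ, v => ∀ n : ℕ, RhoSat T φ (Function.update v x n)
  | .ex x φ, v => ∃ n : ℕ, RhoSat T φ (Function.update v x n)
  | .box φ, v => Provable T (Formula.box (φ.substAll (numeralSubst v)))

/-- Standard-model satisfaction of the π_T-translation: `π_T` is the identity on
L_A-formulas, commutes with connectives and quantifiers, and sends `□φ(x⃗)` to
`Pr_T(⌜φ(ẋ⃗)⌝)`, whose truth in ℕ (for a natural provability predicate) amounts to
provability in `T` of `φ(n̄⃗)`. -/
def PiSat (T : Set Formula) : Formula → (ℕ → ℕ) → Prop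
  | .falsum, _ => False
  | .eq t u, v => t.val v = u.val v
  | .le t u, v => t.val v ≤ u.val v
  | .and φ ψ, v => PiSat T φ v ∧ PiSat T ψ v
  | .or φ ψ, v => PiSat T φ v ∨ PiSat T ψ v
  | .imp φ ψ, v => PiSat T φ v → PiSat T ψ v
  | .neg φ, v => ¬ PiSat T φ v
  | .all x φ, v => ∀ n : ℕ, PiSat T φ (Function.update v x n)
  | .ex x φ, v => ∃ n : ℕ, PiSat T φ (Function.update v x n)
  | .box φ, v => Provable T (φ.substAll (numeralSubst v))

/-- Weak ΣB-soundness: every provable ΣB sentence is true in ℕ under ρ_T. -/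
def WeaklySigmaBSound (T : Set Formula) : Prop :=
  ∀ φ : Formula, IsSigmaB φ → Sentence φ → Provable T φ → RhoSat T φ fun _ => 0

/-- ΣB-soundness: every provable ΣB sentence is true in ℕ under π_T. -/
def SigmaBSound (T : Set Formula) : Prop :=
  ∀ φ : Formula, IsSigmaB φ → Sentence φ → Provable T φ → PiSat T φ fun _ => 0

end ModalArith

namespace ModalArith

abbrev Prv (φ : Formula) : Prop := Provable PAK4 φ

/-- Complete consistent sets containing all theorems. -/
structure Mdl (M : Formula → Prop) : Prop where
  thm : ∀ {a}, Prv a → M a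
  imp : ∀ a b, M (a.imp b) ↔ (M a → M b)
  and : ∀ a b, M (a.and b) ↔ (M a ∧ M b)
  or : ∀ a b, M (a.or b) ↔ (M a ∨ M b)
  neg : ∀ a, M a.neg ↔ ¬ M a
  falsum : ¬ M Formula.falsum

theorem exists_mdl {φ : Formula} (h : ¬ Prv φ) : ∃ M, Mdl M ∧ ¬ M φ := by
  let S : Set (Set Formula) := {M | (∀ a, Prv a → a ∈ M) ∧
    (∀ a b, a.imp b ∈ M → a ∈ M → b ∈ M) ∧ Formula.falsum ∉ M ∧ φ.neg ∈ M}
  have h0 : {b | Prv (φ.neg.imp b)} ∈ S := by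
    refine ⟨fun a ha => ?_, fun a b hab ha => ?_, fun hf => ?_, ?_⟩
    · exact .mp (.logic (.imp1 _ _)) ha
    · exact .mp (.mp (.logic (.imp2 _ _ _)) hab) ha
    · exact h (.mp (.logic (.dne _)) (.mp (.logic (.negIntro _)) hf))
    · exact .mp (.mp (.logic (.imp2 _ (φ.neg.imp φ.neg) _)) (.logic (.imp1 _ _)))
        (.logic (.imp1 _ _))
  obtain ⟨M, -, hM⟩ := zorn_subset_nonempty S (by
    intro c hc hch hne
    refine ⟨⋃₀ c, ⟨fun a ha => ?_, fun a b hab ha => ?_, fun hf => ?_, ?_⟩,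
      fun s hs => Set.subset_sUnion_of_mem hs⟩
    · obtain ⟨s, hs⟩ := hne
      exact ⟨s, hs, (hc hs).1 a ha⟩
    · obtain ⟨s, hs, hs'⟩ := hab
      obtain ⟨u, hu, hu'⟩ := ha
      rcases hch.total hs hu with hsu | hsu
      · exact ⟨u, hu, (hc hu).2.1 a b (hsu hs') hu'⟩
      · exact ⟨s, hs, (hc hs).2.1 a b hs' (hsu hu')⟩
    · obtain ⟨s, hs, hs'⟩ := hf
      exact (hc hs).2.2.1 hs'
    · obtain ⟨s, hs⟩ := hne
      exact ⟨s, hs, (hc hs).2.2.2⟩) _ h0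
  obtain ⟨⟨hthm, hmp, hf, hn⟩, hmax⟩ := hM
  have hl : ∀ {a}, LogicalAxiom a → a ∈ M := fun h => hthm _ (.logic h)
  have key : ∀ a, a ∉ M → a.neg ∈ M := by
    intro a ha
    by_contra hna
    apply ha
    refine hmax (y := {b | a.imp b ∈ M}) ⟨fun b hb => ?_, fun b c hbc hb => ?_, fun hf => ?_, ?_⟩ ?_ ?_
    · exact hthm _ (.mp (.logic (.imp1 _ _)) hb)
    · exact hmp _ _ (hmp _ _ (hl (.imp2 _ _ _)) hbc) hb
    · exact hna (hmp _ _ (hl (.negIntro _)) hf)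
    · exact hmp _ _ (hl (.imp1 _ _)) hn
    · intro b hb
      exact hmp _ _ (hl (.imp1 _ _)) hb
    · exact hmp _ _ (hmp _ _ (hl (.imp2 _ (a.imp a) _)) (hl (.imp1 _ _))) (hl (.imp1 _ _))
  have key2 : ∀ a, a.neg ∈ M → a ∉ M := fun a h1 h2 =>
    hf (hmp _ _ (hmp _ _ (hl (.negElimFalsum _)) h1) h2)
  refine ⟨(· ∈ M), ⟨fun h => hthm _ h, fun a b => ⟨hmp a b, fun hab => ?_⟩, fun a b => ⟨fun hab => ?_, fun hab => ?_⟩,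
    fun a b => ⟨fun hab => ?_, fun hab => ?_⟩, fun a => ⟨key2 a, key a⟩, hf⟩, key2 _ hn⟩
  · by_cases ha : a ∈ M
    · exact hmp _ _ (hl (.imp1 _ _)) (hab ha)
    · exact hmp _ _ (hl (.negE _ _)) (key _ ha)
  · exact ⟨hmp _ _ (hl (.andE1 _ _)) hab, hmp _ _ (hl (.andE2 _ _)) hab⟩
  · exact hmp _ _ (hmp _ _ (hl (.andI _ _)) hab.1) hab.2
  · by_contra hc
    push Not at hc
    exact hf (hmp _ _ (hmp _ _ (hmp _ _ (hl (.orE _ _ _)) (hmp _ _ (hl (.negElimFalsum _)) (key _ hc.1)))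
      (hmp _ _ (hl (.negElimFalsum _)) (key _ hc.2))) hab)
  · rcases hab with hab | hab
    · exact hmp _ _ (hl (.orI1 _ _)) hab
    · exact hmp _ _ (hl (.orI2 _ _)) hab

theorem prove {φ : Formula} (h : ∀ M, Mdl M → M φ) : Prv φ := by
  by_contra hc
  obtain ⟨M, hM, hn⟩ := exists_mdl hc
  exact hn (h M hM)

/-! ### Substitution lemmas -/

theorem Term.substAll_congr (t : Term) {v w : ℕ → Term} (h : ∀ y ∈ t.fv, v y = w y) :
    t.substAll v = t.substAll w := by
  induction t with
  | var x => exact h x (by simp [Term.fv])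
  | zero => rfl
  | succ t ih => simp only [Term.substAll]; rw [ih h]
  | add t u ih1 ih2 | mul t u ih1 ih2 =>
    simp only [Term.substAll]
    rw [ih1 fun y hy => h y (by simp [Term.fv, hy]), ih2 fun y hy => h y (by simp [Term.fv, hy])]

theorem Term.substAll_var (t : Term) : t.substAll Term.var = t := by
  induction t <;> simp_all [Term.substAll]

theorem Term.substAll_comp (t : Term) (v w : ℕ → Term) :
    (t.substAll v).substAll w = t.substAll fun y => (v y).substAll w := by
  induction t <;> simp_all [Term.substAll]

theorem Term.substAll_id (t : Term) {v : ℕ → Term} (h : ∀ y ∈ t.fv, v y = Term.var y) :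
    t.substAll v = t := by
  rw [t.substAll_congr h, t.substAll_var]

theorem Term.mem_fv_substAll (t : Term) {v : ℕ → Term} {y : ℕ} (h : y ∈ (t.substAll v).fv) :
    ∃ w ∈ t.fv, y ∈ (v w).fv := by
  induction t with
  | var x => exact ⟨x, by simp [Term.fv], h⟩
  | zero => simp [Term.substAll, Term.fv] at h
  | succ t ih => exact ih h
  | add t u ih1 ih2 | mul t u ih1 ih2 =>
    simp only [Term.substAll, Term.fv, Finset.mem_union] at h ⊢
    rcases h with h | h
    · obtain ⟨w, h1, h2⟩ := ih1 h; exact ⟨w, .inl h1, h2⟩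
    · obtain ⟨w, h1, h2⟩ := ih2 h; exact ⟨w, .inr h1, h2⟩

theorem upd_var {x y : ℕ} {s : Term} (h : y ≠ x) :
    Function.update (Function.update Term.var x s) y (Term.var y) = Function.update Term.var x s := by
  funext n
  by_cases hn : n = y
  · subst hn; simp [h]
  · simp [hn]

theorem Formula.substAll_congr (φ : Formula) {v w : ℕ → Term} (h : ∀ y ∈ φ.fv, v y = w y) :
    φ.substAll v = φ.substAll w := by
  induction φ generalizing v w with
  | falsum => rfl
  | eq t u | le t u =>
    simp only [Formula.substAll]
    rw [t.substAll_congr fun y hy => h y (by simp [Formula.fv, hy]),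
      u.substAll_congr fun y hy => h y (by simp [Formula.fv, hy])]
  | and φ ψ ih1 ih2 | or φ ψ ih1 ih2 | imp φ ψ ih1 ih2 =>
    simp only [Formula.substAll]
    rw [ih1 fun y hy => h y (by simp [Formula.fv, hy]), ih2 fun y hy => h y (by simp [Formula.fv, hy])]
  | neg φ ih | box φ ih =>
    simp only [Formula.substAll]
    rw [ih h]
  | all x φ ih | ex x φ ih =>
    simp only [Formula.substAll]
    rw [ih]
    intro y hy
    by_cases hyx : y = x
    · subst hyx; simp
    · simp [hyx, h y (by simp [Formula.fv, hy, hyx])]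

theorem Formula.substAll_var (φ : Formula) : φ.substAll Term.var = φ := by
  induction φ <;> simp_all [Formula.substAll, Term.substAll_var]

theorem Formula.substAll_id (φ : Formula) {v : ℕ → Term} (h : ∀ y ∈ φ.fv, v y = Term.var y) :
    φ.substAll v = φ := by
  rw [φ.substAll_congr h, φ.substAll_var]

theorem Formula.subst_self (φ : Formula) (x : ℕ) : φ.subst x (Term.var x) = φ := by
  simp [Formula.subst, Formula.substAll_var]

theorem Formula.mem_fv_substAll (φ : Formula) {v : ℕ → Term} {y : ℕ} (h : y ∈ (φ.substAll v).fv) :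
    ∃ w ∈ φ.fv, y ∈ (v w).fv := by
  induction φ generalizing v with
  | falsum => simp [Formula.substAll, Formula.fv] at h
  | eq t u | le t u =>
    simp only [Formula.substAll, Formula.fv, Finset.mem_union] at h ⊢
    rcases h with h | h
    · obtain ⟨w, h1, h2⟩ := t.mem_fv_substAll h; exact ⟨w, .inl h1, h2⟩
    · obtain ⟨w, h1, h2⟩ := u.mem_fv_substAll h; exact ⟨w, .inr h1, h2⟩
  | and φ ψ ih1 ih2 | or φ ψ ih1 ih2 | imp φ ψ ih1 ih2 =>
    simp only [Formula.substAll, Formula.fv, Finset.mem_union] at h ⊢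
    rcases h with h | h
    · obtain ⟨w, h1, h2⟩ := ih1 h; exact ⟨w, .inl h1, h2⟩
    · obtain ⟨w, h1, h2⟩ := ih2 h; exact ⟨w, .inr h1, h2⟩
  | neg φ ih | box φ ih => exact ih h
  | all x φ ih | ex x φ ih =>
    simp only [Formula.substAll, Formula.fv, Finset.mem_erase] at h ⊢
    obtain ⟨w, h1, h2⟩ := ih h.2
    by_cases hw : w = x
    · subst hw; simp [Term.fv] at h2; exact absurd h2 h.1
    · exact ⟨w, ⟨hw, h1⟩, by simpa [hw] using h2⟩

/-- All variables, free or bound. -/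
def Formula.vars : Formula → Finset ℕ
  | .falsum => ∅
  | .eq t u => t.fv ∪ u.fv
  | .le t u => t.fv ∪ u.fv
  | .and φ ψ => φ.vars ∪ ψ.vars
  | .or φ ψ => φ.vars ∪ ψ.vars
  | .imp φ ψ => φ.vars ∪ ψ.vars
  | .neg φ => φ.vars
  | .all x φ => insert x φ.vars
  | .ex x φ => insert x φ.vars
  | .box φ => φ.vars

theorem Formula.fv_sub_vars (φ : Formula) : φ.fv ⊆ φ.vars := by
  induction φ with
  | falsum => simp [Formula.fv]
  | eq t u | le t u => simp [Formula.fv, Formula.vars]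
  | and φ ψ ih1 ih2 | or φ ψ ih1 ih2 | imp φ ψ ih1 ih2 => exact Finset.union_subset_union ih1 ih2
  | neg φ ih | box φ ih => exact ih
  | all x φ ih | ex x φ ih =>
    exact ((Finset.erase_subset _ _).trans ih).trans (Finset.subset_insert _ _)

theorem Formula.freeFor_of_notMem (φ : Formula) {s : Term} {x : ℕ} (h : x ∉ φ.fv) : φ.freeFor s x := by
  induction φ <;> simp_all [Formula.freeFor, Formula.fv]
  all_goals tauto

theorem Formula.freeFor_fresh (φ : Formula) {z x : ℕ} (h : z ∉ φ.vars) : φ.freeFor (Term.var z) x := by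
  induction φ <;> simp_all [Formula.freeFor, Formula.vars, Term.fv]
  all_goals tauto

theorem Formula.freeFor_self (φ : Formula) {x : ℕ} : φ.freeFor (Term.var x) x := by
  induction φ <;> simp_all [Formula.freeFor, Term.fv]
  all_goals tauto

def Formula.qf : Formula → Prop
  | .falsum => True
  | .eq _ _ => True
  | .le _ _ => True
  | .and φ ψ => φ.qf ∧ ψ.qf
  | .or φ ψ => φ.qf ∧ ψ.qf
  | .imp φ ψ => φ.qf ∧ ψ.qf
  | .neg φ => φ.qf
  | .all _ _ => False
  | .ex _ _ => False
  | .box φ => φ.qf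

theorem Formula.qf.freeFor {φ : Formula} (h : φ.qf) (s : Term) (x : ℕ) : φ.freeFor s x := by
  induction φ <;> simp_all [Formula.freeFor, Formula.qf]

theorem Formula.qf.substAll {φ : Formula} (h : φ.qf) (v : ℕ → Term) : (φ.substAll v).qf := by
  induction φ <;> simp_all [Formula.substAll, Formula.qf]

theorem Formula.qf.comp {φ : Formula} (h : φ.qf) (v w : ℕ → Term) :
    (φ.substAll v).substAll w = φ.substAll fun y => (v y).substAll w := by
  induction φ <;> simp_all [Formula.substAll, Formula.qf, Term.substAll_comp]

/-! ### Derived rules -/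

theorem inst {φ : Formula} (h : Prv φ) (x : ℕ) (t : Term) (hf : φ.freeFor t x) : Prv (φ.subst x t) :=
  .mp (.logic (.allE x t φ hf)) (.gen x h)

theorem ungen {φ : Formula} {x : ℕ} (h : Prv (φ.all x)) : Prv φ := by
  have := Provable.mp (.logic (.allE x (Term.var x) φ φ.freeFor_self)) h
  rwa [Formula.subst_self] at this

theorem all_intro {c φ : Formula} {x : ℕ} (hx : x ∉ c.fv) (h : Prv (c.imp φ)) : Prv (c.imp (φ.all x)) :=
  .mp (.logic (.allImp x c φ hx)) (.gen x h)

theorem all_elim (x : ℕ) (φ : Formula) : Prv ((φ.all x).imp φ) := by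
  have := Provable.logic (T := PAK4) (.allE x (Term.var x) φ φ.freeFor_self)
  rwa [Formula.subst_self] at this

theorem ex_intro (x : ℕ) (φ : Formula) : Prv (φ.imp (φ.ex x)) := by
  have := Provable.logic (T := PAK4) (.exI x (Term.var x) φ φ.freeFor_self)
  rwa [Formula.subst_self] at this

theorem ex_elim {c φ : Formula} {x : ℕ} (hx : x ∉ c.fv) (h : Prv (φ.imp c)) : Prv ((φ.ex x).imp c) :=
  .mp (.logic (.exE x φ c hx)) (.gen x h)

theorem syl {a b c : Formula} (h1 : Prv (a.imp b)) (h2 : Prv (b.imp c)) : Prv (a.imp c) :=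
  prove fun M m => (m.imp _ _).2 fun ha => (m.imp _ _).1 (m.thm h2) ((m.imp _ _).1 (m.thm h1) ha)

theorem all_mono {a b : Formula} (x : ℕ) (h : Prv (a.imp b)) : Prv ((a.all x).imp (b.all x)) :=
  all_intro (by simp [Formula.fv]) (syl (all_elim x a) h)

theorem ex_mono {a b : Formula} (x : ℕ) (h : Prv (a.imp b)) : Prv ((a.ex x).imp (b.ex x)) :=
  ex_elim (by simp [Formula.fv]) (syl h (ex_intro x b))

theorem prvK (a b : Formula) : Prv ((a.imp b).box.imp (a.box.imp b.box)) :=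
  .ax (.inl (.inr ⟨a, b, rfl⟩))

theorem box_mono {a b : Formula} (h : Prv (a.imp b)) : Prv (a.box.imp b.box) :=
  .mp (prvK a b) (.nec h)

theorem box_mono2 {a b c : Formula} (h : Prv (a.imp (b.imp c))) : Prv (a.box.imp (b.box.imp c.box)) :=
  syl (box_mono h) (prvK b c)

theorem ind {φ : Formula} (x : ℕ) (h0 : Prv (φ.subst x Term.zero))
    (h1 : Prv (φ.imp (φ.subst x (Term.var x).succ))) : Prv φ := by
  refine ungen (x := x) (.mp (.ax (.inl (.inl (.inr ⟨x, φ, rfl⟩)))) ?_)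
  exact .mp (.mp (.logic (.andI _ _)) h0) (.gen x h1)

theorem Mdl.mp {M : Formula → Prop} (m : Mdl M) {a b : Formula} (h : Prv (a.imp b)) (ha : M a) : M b :=
  (m.imp _ _).1 (m.thm h) ha

theorem Mdl.mp2 {M : Formula → Prop} (m : Mdl M) {a b c : Formula} (h : Prv (a.imp (b.imp c)))
    (ha : M a) (hb : M b) : M c :=
  (m.imp _ _).1 (m.mp h ha) hb

/-! ### Two-variable formulas -/

def v2 (s t : Term) : ℕ → Term := fun n => if n = 0 then s else if n = 1 then t else Term.var n

theorem sub_v2 {A : Formula} (hq : A.qf) (hv : A.fv ⊆ {0, 1}) (s t : Term) (w : ℕ → Term) :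
    (A.substAll (v2 s t)).substAll w = A.substAll (v2 (s.substAll w) (t.substAll w)) := by
  rw [hq.comp]
  refine A.substAll_congr fun y hy => ?_
  have := hv hy
  simp only [Finset.mem_insert, Finset.mem_singleton] at this
  rcases this with rfl | rfl <;> simp [v2]

theorem v2_id (A : Formula) : A.substAll (v2 (Term.var 0) (Term.var 1)) = A := by
  refine A.substAll_id fun y _ => ?_
  simp only [v2]
  split_ifs <;> simp_all

theorem inst2 {A : Formula} (h : Prv A) (hq : A.qf) (hv : A.fv ⊆ {0, 1}) (s t : Term) :
    Prv (A.substAll (v2 s t)) := by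
  obtain ⟨w, hw⟩ := Infinite.exists_notMem_finset (s.fv ∪ {0, 1})
  simp only [Finset.mem_union, Finset.mem_insert, Finset.mem_singleton, not_or] at hw
  obtain ⟨hws, hw0, hw1⟩ := hw
  have h1 := inst h 1 (Term.var w) (hq.freeFor _ _)
  have h2 := inst h1 0 s ((hq.substAll _).freeFor _ _)
  have h3 := inst h2 w t (((hq.substAll _).substAll _).freeFor _ _)
  convert h3 using 1
  rw [Formula.subst, Formula.subst, Formula.subst, (hq.substAll _).comp, hq.comp]
  refine A.substAll_congr fun y hy => ?_
  have := hv hy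
  simp only [Finset.mem_insert, Finset.mem_singleton] at this
  rcases this with rfl | rfl
  · simp only [v2, if_true, Function.update, Term.substAll]
    simp [Term.substAll]
    symm
    apply Term.substAll_id
    intro y hy
    have : y ≠ w := fun h => hws (h ▸ hy)
    simp [this]
  · simp [v2, Term.substAll, Function.update, hw0]

theorem dind {A : Formula} (hq : A.qf) (hv : A.fv ⊆ {0, 1})
    (h00 : Prv (A.substAll (v2 .zero .zero)))
    (h01 : Prv (A.substAll (v2 .zero (Term.var 1).succ)))
    (h10 : Prv (A.substAll (v2 (Term.var 0).succ .zero)))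
    (h11 : Prv (A.imp (A.substAll (v2 (Term.var 0).succ (Term.var 1).succ)))) : Prv A := by
  have e0 : ∀ s, A.subst 0 s = A.substAll (v2 s (Term.var 1)) := by
    intro s
    refine A.substAll_congr fun y hy => ?_
    have := hv hy
    simp only [Finset.mem_insert, Finset.mem_singleton] at this
    rcases this with rfl | rfl <;> simp [v2]
  have eall : ∀ s, (A.all 1).subst 0 s = (A.substAll (v2 s (Term.var 1))).all 1 := by
    intro s
    rw [← e0]
    simp only [Formula.subst, Formula.substAll]
    rw [upd_var (by decide)]
  refine ungen (x := 1) (ind 0 ?_ ?_)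
  · rw [eall]
    refine .gen 1 (ind 1 ?_ ?_)
    · rw [Formula.subst, sub_v2 hq hv]
      simpa [Term.substAll] using h00
    · rw [Formula.subst, sub_v2 hq hv]
      simp only [Term.substAll, Function.update_self]
      exact .mp (.logic (.imp1 _ _)) h01
  · rw [eall]
    refine all_intro (by simp [Formula.fv]) (ind 1 ?_ ?_)
    · simp only [Formula.subst, Formula.substAll]
      rw [sub_v2 hq hv]
      simp only [Term.substAll, Function.update_self]
      refine .mp (.logic (.imp1 _ _)) ?_
      simpa using h10
    · simp only [Formula.subst, Formula.substAll]
      rw [sub_v2 hq hv]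
      simp only [Term.substAll, Function.update_self, Function.update_idem, ne_eq, zero_ne_one, not_false_eq_true, Function.update_of_ne, Function.update_eq_self]
      rw [A.substAll_var]
      refine .mp (.logic (.imp1 _ _)) (syl (all_elim _ _) h11)

/-! ### Arithmetic -/

theorem base {φ : Formula} (h : φ ∈ baseAxioms) : Prv φ := .ax (.inl (.inl (.inl h)))

theorem p_succ_ne (t : Term) : Prv (Formula.eq t.succ .zero).neg :=
  inst2 (base (φ := succNeZero) (by simp [baseAxioms])) trivial (by decide) t t
theorem p_succ_inj (t u : Term) : Prv ((Formula.eq t.succ u.succ).imp (Formula.eq t u)) :=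
  inst2 (base (φ := succInj) (by simp [baseAxioms])) (by simp [succInj, Formula.qf]) (by decide) t u
theorem p_add_zero (t : Term) : Prv (Formula.eq (t.add .zero) t) :=
  inst2 (base (φ := addZero) (by simp [baseAxioms])) trivial (by decide) t t
theorem p_add_succ (t u : Term) : Prv (Formula.eq (t.add u.succ) (t.add u).succ) :=
  inst2 (base (φ := addSucc) (by simp [baseAxioms])) trivial (by decide) t u

theorem p_refl (t : Term) : Prv (Formula.eq t t) := .logic (.eqRefl t)
theorem p_symm {t u : Term} : Prv ((Formula.eq t u).imp (Formula.eq u t)) := .logic (.eqSymm t u)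
theorem p_trans {t u w : Term} : Prv ((Formula.eq t u).imp ((Formula.eq u w).imp (Formula.eq t w))) :=
  .logic (.eqTrans t u w)
theorem p_congS {t u : Term} : Prv ((Formula.eq t u).imp (Formula.eq t.succ u.succ)) := .logic (.eqSucc t u)

theorem p_zero_add (t : Term) : Prv (Formula.eq (Term.zero.add t) t) := by
  refine inst2 (A := Formula.eq (Term.zero.add (.var 0)) (.var 0)) ?_ trivial (by decide) t t
  refine ind 0 (p_add_zero _) ?_
  change Prv ((Formula.eq (Term.zero.add (.var 0)) (.var 0)).imp
    (Formula.eq (Term.zero.add (Term.var 0).succ) (Term.var 0).succ))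
  refine prove fun M m => (m.imp _ _).2 fun h => ?_
  exact m.mp2 p_trans (m.thm (p_add_succ _ _)) (m.mp p_congS h)

theorem p_succ_add (t u : Term) : Prv (Formula.eq (t.succ.add u) (t.add u).succ) := by
  refine inst2 (A := Formula.eq ((Term.var 0).succ.add (.var 1)) ((Term.var 0).add (.var 1)).succ)
    ?_ trivial (by decide) t u
  refine ind 1 ?_ ?_
  · change Prv (Formula.eq ((Term.var 0).succ.add .zero) ((Term.var 0).add .zero).succ)
    exact prove fun M m => m.mp2 p_trans (m.thm (p_add_zero _)) (m.mp p_congS (m.mp p_symm (m.thm (p_add_zero _))))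
  · change Prv ((Formula.eq ((Term.var 0).succ.add (.var 1)) ((Term.var 0).add (.var 1)).succ).imp
      (Formula.eq ((Term.var 0).succ.add (Term.var 1).succ) ((Term.var 0).add (Term.var 1).succ).succ))
    refine prove fun M m => (m.imp _ _).2 fun h => ?_
    exact m.mp2 p_trans (m.thm (p_add_succ _ _)) (m.mp p_congS
      (m.mp2 p_trans h (m.mp p_symm (m.thm (p_add_succ _ _)))))

theorem leIff {t u : Term} (ht : 1 ∉ t.fv) (ht2 : 2 ∉ t.fv) (hu : 2 ∉ u.fv) :
    Prv ((Formula.le t u).iff (Formula.ex 2 (Formula.eq (t.add (.var 2)) u))) := by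
  have h := base (φ := leDef) (by simp [baseAxioms])
  have h1 := inst h 0 t (by simp [leDef, Formula.iff, Formula.freeFor, ht2])
  have h2 := inst h1 1 u (by
    simp [leDef, Formula.iff, Formula.freeFor, Formula.subst, Formula.substAll, hu])
  have e : t.substAll (Function.update Term.var 1 u) = t :=
    t.substAll_id fun y hy => by
      have : y ≠ 1 := fun h => ht (h ▸ hy)
      simp [this]
  have e2 : t.substAll (Function.update (Function.update Term.var 1 u) 2 (Term.var 2)) = t :=
    t.substAll_id fun y hy => by
      have : y ≠ 1 := fun h => ht (h ▸ hy)
      have : y ≠ 2 := fun h => ht2 (h ▸ hy)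
      simp [*]
  simpa [leDef, Formula.iff, Formula.subst, Formula.substAll, Term.substAll, Function.update, e, e2] using h2

theorem leI {t u : Term} (ht : 1 ∉ t.fv) (ht2 : 2 ∉ t.fv) (hu : 2 ∉ u.fv) :
    Prv ((Formula.ex 2 (Formula.eq (t.add (.var 2)) u)).imp (Formula.le t u)) :=
  .mp (.logic (.andE2 _ _)) (leIff ht ht2 hu)
theorem leE {t u : Term} (ht : 1 ∉ t.fv) (ht2 : 2 ∉ t.fv) (hu : 2 ∉ u.fv) :
    Prv ((Formula.le t u).imp (Formula.ex 2 (Formula.eq (t.add (.var 2)) u))) :=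
  .mp (.logic (.andE1 _ _)) (leIff ht ht2 hu)

theorem p_zero_le (t : Term) : Prv (Formula.le .zero t) := by
  refine inst2 (A := Formula.le .zero (.var 0)) ?_ trivial (by decide) t t
  refine .mp (leI (by decide) (by decide) (by decide)) ?_
  exact .mp (.logic (.exI 2 (.var 0) (Formula.eq (Term.zero.add (.var 2)) (.var 0)) trivial))
    (p_zero_add (.var 0))

theorem p_not_le (t : Term) : Prv (Formula.le t.succ .zero).neg := by
  refine inst2 (A := (Formula.le (Term.var 0).succ .zero).neg) ?_ trivial (by decide) t t
  refine .mp (.logic (.negIntro _)) (syl (leE (by decide) (by decide) (by decide)) (ex_elim (by decide) ?_))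
  refine prove fun M m => (m.imp _ _).2 fun h => ?_
  exact absurd (m.mp2 p_trans (m.mp p_symm (m.thm (p_succ_add _ _))) h) ((m.neg _).1 (m.thm (p_succ_ne _)))

theorem p_le_of_succ (t u : Term) : Prv ((Formula.le t.succ u.succ).imp (Formula.le t u)) := by
  refine inst2 (A := (Formula.le (Term.var 0).succ (Term.var 1).succ).imp (Formula.le (.var 0) (.var 1)))
    ?_ ⟨trivial, trivial⟩ (by decide) t u
  refine syl (leE (by decide) (by decide) (by decide)) (syl (ex_mono 2 ?_) (leI (by decide) (by decide) (by decide)))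
  refine prove fun M m => (m.imp _ _).2 fun h => ?_
  exact m.mp (p_succ_inj _ _) (m.mp2 p_trans (m.mp p_symm (m.thm (p_succ_add _ _))) h)

theorem p_succ_le (t u : Term) : Prv ((Formula.le t u).imp (Formula.le t.succ u.succ)) := by
  refine inst2 (A := (Formula.le (.var 0) (.var 1)).imp (Formula.le (Term.var 0).succ (Term.var 1).succ))
    ?_ ⟨trivial, trivial⟩ (by decide) t u
  refine syl (leE (by decide) (by decide) (by decide)) (syl (ex_mono 2 ?_) (leI (by decide) (by decide) (by decide)))
  refine prove fun M m => (m.imp _ _).2 fun h => ?_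
  exact m.mp2 p_trans (m.thm (p_succ_add _ _)) (m.mp p_congS h)

theorem p_le_refl (t : Term) : Prv (Formula.le t t) := by
  refine inst2 (A := Formula.le (.var 0) (.var 0)) ?_ trivial (by decide) t t
  exact ind 0 (p_zero_le _) (p_succ_le _ _)

theorem p_le_cases (t u : Term) :
    Prv ((Formula.le t u).imp ((Formula.eq t u).or (Formula.le t.succ u))) := by
  refine inst2 (A := (Formula.le (.var 0) (.var 1)).imp ((Formula.eq (.var 0) (.var 1)).or
    (Formula.le (Term.var 0).succ (.var 1)))) ?_ ⟨trivial, trivial, trivial⟩ (by decide) t u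
  refine dind ⟨trivial, trivial, trivial⟩ (by decide) ?_ ?_ ?_ ?_ <;>
    simp only [Formula.substAll, Term.substAll, v2, if_true, one_ne_zero, if_false] <;>
    refine prove fun M m => ?_ <;> simp only [m.imp, m.or]
  · exact fun _ => .inl (m.thm (p_refl _))
  · exact fun _ => .inr (m.mp (p_succ_le _ _) (m.thm (p_zero_le _)))
  · exact fun h => absurd h ((m.neg _).1 (m.thm (p_not_le _)))
  · intro h h1
    rcases h (m.mp (p_le_of_succ _ _) h1) with h | h
    · exact .inl (m.mp p_congS h)
    · exact .inr (m.mp (p_succ_le _ _) h)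

theorem p_le_weak (t u : Term) : Prv ((Formula.le t u).imp (Formula.le t u.succ)) := by
  refine inst2 (A := (Formula.le (.var 0) (.var 1)).imp (Formula.le (.var 0) (Term.var 1).succ))
    ?_ ⟨trivial, trivial⟩ (by decide) t u
  refine dind ⟨trivial, trivial⟩ (by decide) ?_ ?_ ?_ ?_ <;>
    simp only [Formula.substAll, Term.substAll, v2, if_true, one_ne_zero, if_false] <;>
    refine prove fun M m => ?_ <;> simp only [m.imp]
  · exact fun _ => m.thm (p_zero_le _)
  · exact fun _ => m.thm (p_zero_le _)
  · exact fun h => absurd h ((m.neg _).1 (m.thm (p_not_le _)))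
  · intro h h1
    exact m.mp (p_succ_le _ _) (h (m.mp (p_le_of_succ _ _) h1))

/-! ### Atomic formulas -/

def Good (φ : Formula) : Prop := Prv (φ.imp φ.box)

/-- `φ` is decided, boxedly. -/
def Dec2 (φ : Formula) : Formula := (φ.imp φ.box).and (φ.neg.imp φ.neg.box)

theorem dec_of_prv {φ : Formula} (h : Prv φ) : Prv (Dec2 φ) := by
  refine prove fun M m => ?_
  simp only [Dec2, m.and, m.imp, m.neg]
  exact ⟨fun _ => m.thm (.nec h), fun h' => absurd (m.thm h) h'⟩

theorem dec_of_neg {φ : Formula} (h : Prv φ.neg) : Prv (Dec2 φ) := by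
  refine prove fun M m => ?_
  simp only [Dec2, m.and, m.imp, m.neg]
  exact ⟨fun h' => absurd h' ((m.neg _).1 (m.thm h)), fun _ => m.thm (.nec h)⟩

theorem dec_iff {φ ψ : Formula} (h1 : Prv (φ.imp ψ)) (h2 : Prv (ψ.imp φ)) : Prv ((Dec2 φ).imp (Dec2 ψ)) := by
  have h3 : Prv (φ.neg.imp ψ.neg) := prove fun M m => by
    simp only [m.imp, m.neg]
    exact fun h h' => h (m.mp h2 h')
  refine prove fun M m => ?_
  simp only [Dec2, m.and, m.imp, m.neg]
  exact fun h => ⟨fun h' => m.mp (box_mono h1) (h.1 (m.mp h2 h')),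
    fun h' => m.mp (box_mono h3) (h.2 fun hh => h' (m.mp h1 hh))⟩

theorem dec_eq (t u : Term) : Prv (Dec2 (Formula.eq t u)) := by
  refine inst2 (A := Dec2 (Formula.eq (.var 0) (.var 1))) ?_ (by simp [Dec2, Formula.qf]) (by decide) t u
  refine dind (by simp [Dec2, Formula.qf]) (by decide) ?_ ?_ ?_ ?_
  · exact dec_of_prv (p_refl _)
  · refine dec_of_neg (φ := Formula.eq .zero (Term.var 1).succ) ?_
    refine prove fun M m => ?_
    rw [m.neg]
    exact fun h => (m.neg _).1 (m.thm (p_succ_ne (.var 1))) (m.mp p_symm h)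
  · exact dec_of_neg (p_succ_ne (.var 0))
  · exact dec_iff p_congS (p_succ_inj _ _)

theorem dec_le (t u : Term) : Prv (Dec2 (Formula.le t u)) := by
  refine inst2 (A := Dec2 (Formula.le (.var 0) (.var 1))) ?_ (by simp [Dec2, Formula.qf]) (by decide) t u
  refine dind (by simp [Dec2, Formula.qf]) (by decide) ?_ ?_ ?_ ?_
  · exact dec_of_prv (p_zero_le _)
  · exact dec_of_prv (p_zero_le (Term.var 1).succ)
  · exact dec_of_neg (p_not_le (.var 0))
  · exact dec_iff (p_succ_le _ _) (p_le_of_succ _ _)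

theorem good_of_dec {φ : Formula} (h : Prv (Dec2 φ)) : Good φ ∧ Good φ.neg :=
  ⟨.mp (.logic (.andE1 _ _)) h, .mp (.logic (.andE2 _ _)) h⟩

/-! ### Leibniz -/

theorem leib_term (t : Term) (x z : ℕ) :
    Prv ((Formula.eq (.var x) (.var z)).imp (Formula.eq t (t.substAll (Function.update Term.var x (.var z))))) := by
  refine prove fun M m => (m.imp _ _).2 fun h => ?_
  induction t with
  | var y =>
    by_cases hy : y = x
    · subst hy; simpa [Term.subst, Term.substAll] using h
    · simpa [Term.subst, Term.substAll, hy] using m.thm (p_refl (Term.var y))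
  | zero => exact m.thm (p_refl _)
  | succ t ih => exact m.mp p_congS ih
  | add t u ih1 ih2 => exact m.mp2 (.logic (.eqAdd _ _ _ _)) ih1 ih2
  | mul t u ih1 ih2 => exact m.mp2 (.logic (.eqMul _ _ _ _)) ih1 ih2

theorem leib (φ : Formula) (x z : ℕ) (hz : z ∉ φ.vars) :
    Prv ((Formula.eq (.var x) (.var z)).imp (φ.imp (φ.subst x (.var z)))) ∧
    Prv ((Formula.eq (.var x) (.var z)).imp ((φ.subst x (.var z)).imp φ)) := by
  induction φ with
  | falsum =>
    constructor <;> refine prove fun M m => ?_ <;>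
      simp only [m.imp, Formula.subst, Formula.substAll] <;> tauto
  | eq t u =>
    constructor <;> refine prove fun M m => ?_ <;>
      simp only [m.imp, Formula.subst, Formula.substAll] <;> intro h h1 <;>
      have ht := m.mp (leib_term t x z) h <;> have hu := m.mp (leib_term u x z) h
    · exact m.mp2 p_trans (m.mp p_symm ht) (m.mp2 p_trans h1 hu)
    · exact m.mp2 p_trans ht (m.mp2 p_trans h1 (m.mp p_symm hu))
  | le t u =>
    constructor <;> refine prove fun M m => ?_ <;>
      simp only [m.imp, Formula.subst, Formula.substAll] <;> intro h h1 <;>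
      have ht := m.mp (leib_term t x z) h <;> have hu := m.mp (leib_term u x z) h
    · exact (m.imp _ _).1 (m.mp2 (.logic (.eqLe _ _ _ _)) ht hu) h1
    · exact (m.imp _ _).1 (m.mp2 (.logic (.eqLe _ _ _ _)) (m.mp p_symm ht) (m.mp p_symm hu)) h1
  | and φ ψ ih1 ih2 | or φ ψ ih1 ih2 | imp φ ψ ih1 ih2 =>
    simp only [Formula.vars, Finset.mem_union, not_or] at hz
    obtain ⟨a1, a2⟩ := ih1 hz.1
    obtain ⟨b1, b2⟩ := ih2 hz.2
    constructor <;> refine prove fun M m => ?_ <;>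
      have a1 := m.thm a1 <;> have a2 := m.thm a2 <;> have b1 := m.thm b1 <;> have b2 := m.thm b2 <;>
      simp only [m.imp, m.and, m.or, Formula.subst, Formula.substAll] at * <;> tauto
  | neg φ ih =>
    obtain ⟨a1, a2⟩ := ih hz
    constructor <;> refine prove fun M m => ?_ <;>
      have a1 := m.thm a1 <;> have a2 := m.thm a2 <;>
      simp only [m.imp, m.neg, Formula.subst, Formula.substAll] at * <;> tauto
  | box φ ih =>
    obtain ⟨a1, a2⟩ := ih hz
    have g := (good_of_dec (dec_eq (.var x) (.var z))).1
    exact ⟨syl g (box_mono2 a1), syl g (box_mono2 a2)⟩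
  | all y φ ih =>
    simp only [Formula.vars, Finset.mem_insert, not_or] at hz
    obtain ⟨a1, a2⟩ := ih hz.2
    by_cases hy : y = x
    · subst hy
      have e : (φ.all y).subst y (.var z) = φ.all y := by
        simp [Formula.subst, Formula.substAll, Formula.substAll_var]
      rw [e]
      constructor <;> refine prove fun M m => ?_ <;> simp only [m.imp] <;> tauto
    · have e : (φ.all y).subst x (.var z) = (φ.subst x (.var z)).all y := by
        simp only [Formula.subst, Formula.substAll]
        rw [upd_var hy]
      rw [e]
      have hyz : y ∉ (Formula.eq (.var x) (.var z)).fv := by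
        simp [Formula.fv, Term.fv, hy, Ne.symm hz.1]
      constructor
      · refine syl (all_intro hyz a1) ?_
        refine prove fun M m => ?_
        simp only [m.imp]
        intro h1 h2
        have : Prv (((φ.imp (φ.subst x (.var z))).all y).imp ((φ.all y).imp ((φ.subst x (.var z)).all y))) := by
          have : Prv ((((φ.imp (φ.subst x (.var z))).all y).and (φ.all y)).imp ((φ.subst x (.var z)).all y)) := by
            refine all_intro (by simp [Formula.fv]) (prove fun M m => ?_)
            simp only [m.imp, m.and]
            exact fun h => (m.imp _ _).1 (m.mp (all_elim _ _) h.1) (m.mp (all_elim _ _) h.2)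
          refine prove fun M m => ?_
          have := m.thm this
          simp only [m.imp, m.and] at this ⊢
          exact fun a b => this ⟨a, b⟩
        exact m.mp2 this h1 h2
      · refine syl (all_intro hyz a2) ?_
        refine prove fun M m => ?_
        simp only [m.imp]
        intro h1 h2
        have : Prv (((((φ.subst x (.var z)).imp φ).all y).and ((φ.subst x (.var z)).all y)).imp (φ.all y)) := by
          refine all_intro (by simp [Formula.fv]) (prove fun M m => ?_)
          simp only [m.imp, m.and]
          exact fun h => (m.imp _ _).1 (m.mp (all_elim _ _) h.1) (m.mp (all_elim _ _) h.2)
        exact m.mp this ((m.and _ _).2 ⟨h1, h2⟩)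
  | ex y φ ih =>
    simp only [Formula.vars, Finset.mem_insert, not_or] at hz
    obtain ⟨a1, a2⟩ := ih hz.2
    by_cases hy : y = x
    · subst hy
      have e : (φ.ex y).subst y (.var z) = φ.ex y := by
        simp [Formula.subst, Formula.substAll, Formula.substAll_var]
      rw [e]
      constructor <;> refine prove fun M m => ?_ <;> simp only [m.imp] <;> tauto
    · have e : (φ.ex y).subst x (.var z) = (φ.subst x (.var z)).ex y := by
        simp only [Formula.subst, Formula.substAll]
        rw [upd_var hy]
      rw [e]
      have hyz : y ∉ (Formula.eq (.var x) (.var z)).fv := by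
        simp [Formula.fv, Term.fv, hy, Ne.symm hz.1]
      have key : ∀ {a b : Formula}, Prv ((Formula.eq (.var x) (.var z)).imp (a.imp b)) →
          Prv ((Formula.eq (.var x) (.var z)).imp ((a.ex y).imp (b.ex y))) := by
        intro a b h
        have : Prv ((a.ex y).imp ((Formula.eq (.var x) (.var z)).imp (b.ex y))) := by
          refine ex_elim ?_ (prove fun M m => ?_)
          · have : y ∉ (b.ex y).fv := by simp [Formula.fv]
            rw [Formula.fv, Finset.mem_union, not_or]
            exact ⟨hyz, this⟩
          · simp only [m.imp]
            exact fun h1 h2 => m.mp (ex_intro _ _) (m.mp2 h h2 h1)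
        refine prove fun M m => ?_
        have := m.thm this
        simp only [m.imp] at this ⊢
        exact fun h1 h2 => this h2 h1
      exact ⟨key a1, key a2⟩

/-! ### Closure properties -/

theorem good_and {φ ψ : Formula} (h1 : Good φ) (h2 : Good ψ) : Good (φ.and ψ) := by
  refine prove fun M m => ?_
  simp only [m.imp, m.and]
  exact fun h => m.mp2 (box_mono2 (.logic (.andI _ _))) (m.mp h1 h.1) (m.mp h2 h.2)

theorem good_or {φ ψ : Formula} (h1 : Good φ) (h2 : Good ψ) : Good (φ.or ψ) := by
  refine prove fun M m => ?_
  simp only [m.imp, m.or]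
  rintro (h | h)
  · exact m.mp (box_mono (.logic (.orI1 _ _))) (m.mp h1 h)
  · exact m.mp (box_mono (.logic (.orI2 _ _))) (m.mp h2 h)

theorem good_ex {φ : Formula} (x : ℕ) (h : Good φ) : Good (φ.ex x) :=
  ex_elim (by simp [Formula.fv]) (syl h (box_mono (ex_intro x φ)))

theorem good_equiv {φ ψ : Formula} (h : Good φ) (h1 : Prv (φ.imp ψ)) (h2 : Prv (ψ.imp φ)) : Good ψ :=
  syl h2 (syl h (box_mono h1))

theorem good_ball {φ : Formula} {x : ℕ} {t : Term} (hx : x ∉ t.fv) (h : Good φ) :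
    Good (Formula.ball x t φ) := by
  obtain ⟨z, hz⟩ := Infinite.exists_notMem_finset (insert x φ.vars)
  simp only [Finset.mem_insert, not_or] at hz
  obtain ⟨hzx, hz⟩ := hz
  have hzf : z ∉ φ.fv := fun h => hz (φ.fv_sub_vars h)
  have hsub : ∀ s : Term, (Formula.ball x (.var z) φ).subst z s = Formula.ball x s φ := by
    intro s
    simp only [Formula.ball, Formula.lt, Formula.subst, Formula.substAll, Term.substAll, Function.update_self,
      ne_eq, hzx, not_false_eq_true, Function.update_of_ne]
    rw [φ.substAll_id]
    intro y hy
    have : y ≠ z := fun h => hzf (h ▸ hy)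
    by_cases hyx : y = x
    · subst hyx; simp
    · simp [this, hyx]
  have hsub' : ∀ s : Term, ((Formula.ball x (.var z) φ).imp (Formula.ball x (.var z) φ).box).subst z s
      = (Formula.ball x s φ).imp (Formula.ball x s φ).box := by
    intro s
    rw [← hsub s]
    rfl
  have main : Good (Formula.ball x (.var z) φ) := by
    refine ind z ?_ ?_
    · rw [hsub']
      have : Prv (Formula.ball x .zero φ) := by
        refine .gen x (prove fun M m => ?_)
        rw [m.imp]
        exact fun h => absurd h ((m.neg _).1 (m.thm (p_not_le _)))
      exact .mp (.logic (.imp1 _ _)) (.nec this)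
    · rw [hsub']
      have k1 : Prv ((Formula.ball x (Term.var z).succ φ).imp (Formula.ball x (.var z) φ)) := by
        refine all_mono x (prove fun M m => ?_)
        simp only [m.imp]
        exact fun h h1 => h (m.mp (p_le_weak _ _) h1)
      have k2 : Prv ((Formula.ball x (Term.var z).succ φ).imp (φ.subst x (.var z))) := by
        have a := Provable.logic (T := PAK4) (.allE x (.var z)
          ((Formula.lt (.var x) (Term.var z).succ).imp φ) ⟨trivial, φ.freeFor_fresh hz⟩)
        refine prove fun M m => (m.imp _ _).2 fun h => ?_
        have b := m.mp a h
        simp only [Formula.subst, Formula.substAll, Formula.lt, m.imp] at b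
        refine b ?_
        simp only [Term.substAll, Function.update_self, ne_eq, hzx, not_false_eq_true, Function.update_of_ne]
        exact m.thm (p_le_refl _)
      have k3 : Good (φ.subst x (.var z)) :=
        inst h x (.var z) ⟨φ.freeFor_fresh hz, φ.freeFor_fresh hz⟩
      have k4 : Prv ((Formula.ball x (.var z) φ).imp ((φ.subst x (.var z)).imp
          (Formula.ball x (Term.var z).succ φ))) := by
        have : Prv (((Formula.ball x (.var z) φ).and (φ.subst x (.var z))).imp
          (Formula.ball x (Term.var z).succ φ)) := by
          refine all_intro ?_ (prove fun M m => ?_)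
          · rw [Formula.fv, Finset.mem_union, not_or]
            refine ⟨by simp [Formula.ball, Formula.fv], fun hh => ?_⟩
            obtain ⟨w, h1, h2⟩ := φ.mem_fv_substAll hh
            by_cases hw : w = x
            · subst hw; simp [Term.fv] at h2; exact hzx h2.symm
            · simp [Term.fv, hw] at h2; exact hw h2.symm
          · simp only [m.imp, m.and]
            rintro ⟨h1, h2⟩ h3
            have h4 := (m.imp _ _).1 (m.mp (all_elim _ _) h1)
            rcases (m.or _ _).1 (m.mp (p_le_cases _ _) (m.mp (p_le_of_succ _ _) h3)) with h5 | h5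
            · exact (m.imp _ _).1 (m.mp (leib φ x z hz).2 h5) h2
            · exact h4 h5
        refine prove fun M m => ?_
        have := m.thm this
        simp only [m.imp, m.and] at this ⊢
        exact fun a b => this ⟨a, b⟩
      refine prove fun M m => ?_
      simp only [m.imp]
      exact fun ih hb => m.mp2 (box_mono2 k4) (ih (m.mp k1 hb)) (m.mp k3 (m.mp k2 hb))
  have hff : (Formula.ball x (.var z) φ).freeFor t z := by
    simp [Formula.ball, Formula.lt, Formula.freeFor, hx, φ.freeFor_of_notMem hzf]
  have := inst main z t ⟨hff, hff⟩
  rwa [hsub'] at this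

theorem good_delta0 {φ : Formula} (h : IsDelta0 φ) : Good φ ∧ Good φ.neg := by
  induction h with
  | falsum =>
    refine ⟨.logic (.falsumE _), .mp (.logic (.imp1 _ _)) (.nec (prove fun M m => ?_))⟩
    exact (m.neg _).2 m.falsum
  | eq t u => exact good_of_dec (dec_eq t u)
  | le t u => exact good_of_dec (dec_le t u)
  | and _ _ ih1 ih2 =>
    refine ⟨good_and ih1.1 ih2.1, good_equiv (good_or ih1.2 ih2.2) ?_ ?_⟩ <;>
      refine prove fun M m => ?_ <;> simp only [m.imp, m.or, m.and, m.neg] <;> tauto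
  | or _ _ ih1 ih2 =>
    refine ⟨good_or ih1.1 ih2.1, good_equiv (good_and ih1.2 ih2.2) ?_ ?_⟩ <;>
      refine prove fun M m => ?_ <;> simp only [m.imp, m.or, m.and, m.neg] <;> tauto
  | imp _ _ ih1 ih2 =>
    refine ⟨good_equiv (good_or ih1.2 ih2.1) ?_ ?_, good_equiv (good_and ih1.1 ih2.2) ?_ ?_⟩ <;>
      refine prove fun M m => ?_ <;> simp only [m.imp, m.or, m.and, m.neg] <;> tauto
  | neg _ ih =>
    refine ⟨ih.2, good_equiv ih.1 ?_ ?_⟩ <;>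
      refine prove fun M m => ?_ <;> simp only [m.imp, m.neg] <;> tauto
  | @ball x t φ hx _ ih =>
    refine ⟨good_ball hx ih.1, good_equiv
      (good_ex x (good_and (good_of_dec (dec_le (Term.var x).succ t)).1 ih.2)) ?_ ?_⟩
    · refine ex_elim (by simp [Formula.fv, Formula.ball]) (prove fun M m => ?_)
      simp only [m.imp, m.and, m.neg]
      exact fun h h1 => h.2 ((m.imp _ _).1 (m.mp (all_elim _ _) h1) h.1)
    · have : Prv ((((Formula.le (Term.var x).succ t).and φ.neg).ex x).neg.imp (Formula.ball x t φ)) := by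
        refine all_intro (by simp [Formula.fv]) (prove fun M m => ?_)
        simp only [m.imp, m.neg]
        intro h h1
        by_contra hc
        exact h (m.mp (ex_intro _ _) ((m.and _ _).2 ⟨h1, (m.neg _).2 hc⟩))
      refine prove fun M m => ?_
      have := m.thm this
      simp only [m.imp, m.neg] at this ⊢
      tauto
  | @bex x t φ hx _ ih =>
    refine ⟨good_ex x (good_and (good_of_dec (dec_le (Term.var x).succ t)).1 ih.1),
      good_equiv (good_ball hx ih.2) ?_ ?_⟩
    · have : Prv ((Formula.bex x t φ).imp (Formula.ball x t φ.neg).neg) := by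
        refine ex_elim (by simp [Formula.fv, Formula.ball]) (prove fun M m => ?_)
        simp only [m.imp, m.and, m.neg]
        exact fun h h1 => (m.neg _).1 ((m.imp _ _).1 (m.mp (all_elim _ _) h1) h.1) h.2
      refine prove fun M m => ?_
      have := m.thm this
      simp only [m.imp, m.neg] at this ⊢
      tauto
    · refine all_intro (by simp [Formula.fv, Formula.bex]) (prove fun M m => ?_)
      simp only [m.imp, m.neg]
      exact fun h h1 h2 => h (m.mp (ex_intro _ _) ((m.and _ _).2 ⟨h1, h2⟩))

theorem good_sigma1 {φ : Formula} (h : IsSigma1 φ) : Good φ := by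
  induction h with
  | delta0 h => exact (good_delta0 h).1
  | and _ _ h1 h2 => exact good_and h1 h2
  | or _ _ h1 h2 => exact good_or h1 h2
  | ex _ h => exact good_ex _ h
  | ball hx _ h => exact good_ball hx h

/-- Formalized ΣB-completeness: for every ΣB formula φ, PA(K4) ⊢ φ → □φ. -/
theorem statement7 (φ : Formula) (h : IsSigmaB φ) :
    Provable PAK4 (φ.imp (Formula.box φ)) := by
  change Good φ
  induction h with
  | sigma1 h => exact good_sigma1 h
  | b ψ => exact .ax (.inr ⟨ψ, rfl⟩)
  | and _ _ h1 h2 => exact good_and h1 h2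
  | or _ _ h1 h2 => exact good_or h1 h2
  | ex _ h => exact good_ex _ h
  | ball hx _ h => exact good_ball hx h

end ModalArith
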